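/- Let Δ = ℤ ⋊_φ ℤ, where φ : ℤ → Aut(ℤ) sends 1 to the inversion automorphism n ↦ -n, with generating set S = {(2,0),(-2,0),(3,0),(-3,0),(0,1),(0,-1)}. Then the Borel chromatic number of the shift graph of (Δ,S) is greater than 3: there is no Borel 3-coloring of the shift graph. -/

import Mathlib

open Multiplicative

section Defs

variable {G : Type*} [Group G]

/-- The left shift action of `g : G` on `x : G → Bool` (`2^G` with `2 = Bool`):
`(g · x)(h) = x (g⁻¹ h)`. -/
def shiftMap (g : G) (x : G → Bool) : G → Bool := fun h => x (g⁻¹ * h)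

/-- The free part `F(2^G)` of the left shift action. -/
def FreePart (G : Type*) [Group G] : Set (G → Bool) :=
  {x | ∀ g : G, g ≠ 1 → shiftMap g x ≠ x}

/-- Adjacency in the shift graph of the marked group `(G, S)`: distinct `x, y ∈ F(2^G)`
are adjacent iff `y = s · x` for some `s ∈ S`. -/
def ShiftAdj (S : Set G) (x y : FreePart G) : Prop :=
  x ≠ y ∧ ∃ s ∈ S, (y : G → Bool) = shiftMap s (x : G → Bool)

/-- Adjacency in the Cayley graph of `(G, S)`: distinct `g, h` are adjacent iff
`h = s * g` for some `s ∈ S`. -/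
def CayleyAdj (S : Set G) (g h : G) : Prop :=
  g ≠ h ∧ ∃ s ∈ S, h = s * g

/-- `(G, S)` is a marked group: `S` is a finite symmetric generating set
not containing the identity. -/
def IsMarkedGroup (S : Set G) : Prop :=
  S.Finite ∧ (∀ s ∈ S, s⁻¹ ∈ S) ∧ (1 : G) ∉ S ∧ Subgroup.closure S = ⊤

end Defs

/-- A graph (given by its adjacency relation) has an `n`-coloring. -/
def HasColoring {X : Type*} (Adj : X → X → Prop) (n : ℕ) : Prop :=
  ∃ c : X → Fin n, ∀ x y, Adj x y → c x ≠ c y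

/-- The chromatic number: the least `n` admitting an `n`-coloring. -/
noncomputable def chromatic {X : Type*} (Adj : X → X → Prop) : ℕ :=
  sInf {n | HasColoring Adj n}

/-- A graph on a measurable space has a Borel `n`-coloring. -/
def HasBorelColoring {X : Type*} [MeasurableSpace X] (Adj : X → X → Prop) (n : ℕ) : Prop :=
  ∃ c : X → Fin n, Measurable c ∧ ∀ x y, Adj x y → c x ≠ c y

/-- The Borel chromatic number: the least `n` admitting a Borel `n`-coloring. -/
noncomputable def borelChromatic {X : Type*} [MeasurableSpace X] (Adj : X → X → Prop) : ℕ :=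
  sInf {n | HasBorelColoring Adj n}
/-- The homomorphism `ℤ → Aut(ℤ)` (written multiplicatively) sending `1` to the
inversion automorphism `n ↦ -n`. -/
def phiZ : Multiplicative ℤ →* MulAut (Multiplicative ℤ) :=
  zpowersHom (MulAut (Multiplicative ℤ)) (MulEquiv.inv (Multiplicative ℤ))

/-- The group `Δ = ℤ ⋊_φ ℤ`, `φ` sending `1` to inversion. -/
abbrev DeltaZ : Type := SemidirectProduct (Multiplicative ℤ) (Multiplicative ℤ) phiZ

/-- The generating set `S = {(2,0), (-2,0), (3,0), (-3,0), (0,1), (0,-1)}` of `Δ`. -/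
def SZ : Set DeltaZ :=
  {⟨ofAdd (2 : ℤ), ofAdd (0 : ℤ)⟩, ⟨ofAdd (-2 : ℤ), ofAdd (0 : ℤ)⟩,
   ⟨ofAdd (3 : ℤ), ofAdd (0 : ℤ)⟩, ⟨ofAdd (-3 : ℤ), ofAdd (0 : ℤ)⟩,
   ⟨ofAdd (0 : ℤ), ofAdd (1 : ℤ)⟩, ⟨ofAdd (0 : ℤ), ofAdd (-1 : ℤ)⟩}

section Aux

instance : Countable DeltaZ := 
  (SemidirectProduct.equivProd (φ := phiZ)).injective.countable

/-- translation elements -/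
def tr (n : ℤ) : DeltaZ := SemidirectProduct.inl (ofAdd n)

/-- flip -/
def fl : DeltaZ := SemidirectProduct.inr (ofAdd 1)

lemma tr_inj : Function.Injective tr :=
  SemidirectProduct.inl_injective.comp ofAdd.injective

instance : Infinite DeltaZ := Infinite.of_injective tr tr_inj

lemma tr_add (m n : ℤ) : tr (m + n) = tr m * tr n := by
  simp [tr, ofAdd_add]

lemma tr_zero : tr 0 = 1 := by simp [tr]

lemma fl_tr (n : ℤ) : fl * tr n = tr (-n) * fl := by
  have h := SemidirectProduct.inl_aut (φ := phiZ) (ofAdd 1) (ofAdd n)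
  have h2 : phiZ (ofAdd 1) (ofAdd n) = ofAdd (-n) := by simp [phiZ]
  rw [h2] at h
  unfold fl tr
  rw [h]; simp [mul_assoc, ← map_mul]

lemma shiftMap_mul {G : Type*} [Group G] (g h : G) (x : G → Bool) :
    shiftMap (g * h) x = shiftMap g (shiftMap h x) := by
  funext k; simp [shiftMap, mul_assoc]

lemma shiftMap_one {G : Type*} [Group G] (x : G → Bool) : shiftMap 1 x = x := by
  funext k; simp [shiftMap]

lemma shiftMap_mem {G : Type*} [Group G] (g : G) {x : G → Bool} (hx : x ∈ FreePart G) :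
    shiftMap g x ∈ FreePart G := by
  intro k hk he
  apply hx (g⁻¹ * k * g)
  · intro h
    apply hk
    have : k = g * (g⁻¹ * k * g) * g⁻¹ := by group
    rw [this, h]; group
  · rw [shiftMap_mul, shiftMap_mul, he, ← shiftMap_mul]
    simp [shiftMap_one]

/-- the action on the free part -/
def act {G : Type*} [Group G] (g : G) (x : FreePart G) : FreePart G :=
  ⟨shiftMap g x, shiftMap_mem g x.2⟩

lemma act_mul {G : Type*} [Group G] (g h : G) (x : FreePart G) :
    act (g * h) x = act g (act h x) := Subtype.ext (shiftMap_mul g h x)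

lemma act_one {G : Type*} [Group G] (x : FreePart G) : act 1 x = x :=
  Subtype.ext (shiftMap_one x.1)

lemma act_ne {G : Type*} [Group G] {g : G} (hg : g ≠ 1) (x : FreePart G) : x ≠ act g x :=
  fun h => x.2 g hg (congrArg Subtype.val h).symm

lemma shiftMap_measurable {G : Type*} [Group G] (g : G) :
    Measurable (shiftMap g : (G → Bool) → (G → Bool)) :=
  measurable_pi_lambda _ fun h => measurable_pi_apply (g⁻¹ * h)

lemma shiftMap_continuous {G : Type*} [Group G] (g : G) :
    Continuous (shiftMap g : (G → Bool) → (G → Bool)) :=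
  continuous_pi fun h => continuous_apply (g⁻¹ * h)

lemma act_measurable {G : Type*} [Group G] (g : G) :
    Measurable (act g : FreePart G → FreePart G) :=
  ((shiftMap_measurable g).comp measurable_subtype_coe).subtype_mk

/-! Finite Borel colorings exist. -/

/-- a third color -/
def pick (a b : Fin 3) : Fin 3 :=
  if a ≠ 0 ∧ b ≠ 0 then 0 else if a ≠ 1 ∧ b ≠ 1 then 1 else 2

lemma pick_left : ∀ a b, pick a b ≠ a := by decide
lemma pick_right : ∀ a b, pick a b ≠ b := by decide

/-- greedy coloring stages -/
def greedy {X : Type*} (T T' : X → X) (c : X → ℕ) : ℕ → X → Fin 3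
  | 0 => fun _ => 0
  | n + 1 => fun x =>
      if c x = n then pick (greedy T T' c n (T x)) (greedy T T' c n (T' x))
      else greedy T T' c n x

lemma greedy_stable {X : Type*} (T T' : X → X) (c : X → ℕ) (x : X) (k : ℕ) :
    greedy T T' c (c x + 1 + k) x = greedy T T' c (c x + 1) x := by
  induction k with
  | zero => rfl
  | succ k ih =>
    rw [← ih, ← add_assoc]
    exact if_neg (by omega)

lemma greedy_measurable {X : Type*} [MeasurableSpace X] (T T' : X → X) (c : X → ℕ)
    (hT : Measurable T) (hT' : Measurable T') (hc : Measurable c) (n : ℕ) :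
    Measurable (greedy T T' c n) := by
  induction n with
  | zero => exact measurable_const
  | succ n ih =>
    have h : Measurable fun p : Fin 3 × Fin 3 => pick p.1 p.2 := measurable_of_countable _
    exact Measurable.ite (hc (measurableSet_singleton n))
      (h.comp ((ih.comp hT).prodMk (ih.comp hT'))) ih

lemma single_coloring {X : Type*} [MeasurableSpace X] (T T' : X → X) (c : X → ℕ)
    (hT : Measurable T) (hT' : Measurable T') (hc : Measurable c)
    (hinv : ∀ x, T' (T x) = x) (hne : ∀ x, c x ≠ c (T x)) :
    ∃ d : X → Fin 3, Measurable d ∧ ∀ x, d x ≠ d (T x) := by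
  refine ⟨fun x => greedy T T' c (c x + 1) x, ?_, ?_⟩
  · have h : Measurable fun p : ℕ × X => greedy T T' c (p.1 + 1) p.2 :=
      measurable_from_prod_countable_right fun n => greedy_measurable T T' c hT hT' hc (n + 1)
    exact h.comp (hc.prodMk measurable_id)
  · intro x
    show greedy T T' c (c x + 1) x ≠ greedy T T' c (c (T x) + 1) (T x)
    rcases lt_or_gt_of_ne (hne x) with h | h
    · obtain ⟨k, hk⟩ := Nat.exists_eq_add_of_le (Nat.succ_le_of_lt h)
      have h1 : greedy T T' c (c (T x) + 1) (T x) =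
          pick (greedy T T' c (c (T x)) (T (T x))) (greedy T T' c (c (T x)) (T' (T x))) := by
        exact if_pos rfl
      rw [h1, hinv]
      have h2 := greedy_stable T T' c x k
      rw [show c x + 1 + k = c (T x) from hk.symm] at h2
      rw [← h2]
      exact (pick_right _ _).symm
    · obtain ⟨k, hk⟩ := Nat.exists_eq_add_of_le (Nat.succ_le_of_lt h)
      have h1 : greedy T T' c (c x + 1) x =
          pick (greedy T T' c (c x) (T x)) (greedy T T' c (c x) (T' x)) := by
        exact if_pos rfl
      rw [h1]
      have h2 := greedy_stable T T' c (T x) k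
      rw [show c (T x) + 1 + k = c x from hk.symm] at h2
      rw [← h2]
      exact pick_left _ _

lemma nat_coloring (g : DeltaZ) (hg : g ≠ 1) :
    ∃ c : FreePart DeltaZ → ℕ, Measurable c ∧ ∀ x, c x ≠ c (act g x) := by
  classical
  obtain ⟨e, he⟩ := exists_surjective_nat DeltaZ
  have hex : ∀ x : FreePart DeltaZ, ∃ n, x.1 (e n) ≠ x.1 (g⁻¹ * e n) := by
    intro x
    by_contra! h
    apply x.2 g hg
    funext k
    obtain ⟨n, rfl⟩ := he k
    exact (h n).symm
  have hev : ∀ k : DeltaZ, Measurable fun x : FreePart DeltaZ => x.1 k := fun k =>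
    (measurable_pi_apply k).comp measurable_subtype_coe
  have hn : Measurable fun x : FreePart DeltaZ => Nat.find (hex x) := by
    apply measurable_find
    intro n
    have := measurableSet_eq_fun (hev (e n)) (hev (g⁻¹ * e n))
    exact this.compl
  have hb : Measurable fun x : FreePart DeltaZ => x.1 (e (Nat.find (hex x))) := by
    have h : Measurable fun p : ℕ × FreePart DeltaZ => p.2.1 (e p.1) :=
      measurable_from_prod_countable_right fun n => hev (e n)
    exact h.comp (hn.prodMk measurable_id)
  refine ⟨fun x => Encodable.encode (Nat.find (hex x), x.1 (e (Nat.find (hex x)))), ?_, ?_⟩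
  · have h : Measurable fun p : ℕ × Bool => Encodable.encode p := measurable_of_countable _
    exact h.comp (hn.prodMk hb)
  · intro x h
    have h := Encodable.encode_injective h
    simp only [Prod.mk.injEq] at h
    obtain ⟨h1, h2⟩ := h
    rw [← h1] at h2
    exact Nat.find_spec (hex x) h2

lemma SZ_ne_one {s : DeltaZ} (hs : s ∈ SZ) : s ≠ 1 := by
  rintro rfl
  simp [SZ, SemidirectProduct.ext_iff] at hs
  rcases hs with h | h | h <;> exact absurd (congrArg toAdd h) (by decide)

lemma exists_finite_coloring : ∃ n, HasBorelColoring (ShiftAdj SZ) n := by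
  have key : ∀ s : SZ, ∃ d : FreePart DeltaZ → Fin 3, Measurable d ∧
      ∀ x, d x ≠ d (act s.1 x) := by
    intro s
    obtain ⟨c, hc, hne⟩ := nat_coloring s.1 (SZ_ne_one s.2)
    refine single_coloring (act s.1) (act s.1⁻¹) c (act_measurable _) (act_measurable _) hc ?_ hne
    intro x
    rw [← act_mul, inv_mul_cancel, act_one]
  choose d hd hne using key
  have : Finite SZ := by
    have : SZ.Finite := by unfold SZ; exact Set.toFinite _
    exact this.to_subtype
  obtain ⟨n, ⟨φ⟩⟩ := Finite.exists_equiv_fin (SZ → Fin 3)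
  refine ⟨n, fun x => φ fun s => d s x, ?_, ?_⟩
  · exact (measurable_of_countable φ).comp (measurable_pi_lambda _ hd)
  · rintro x y ⟨-, s, hs, hy⟩ h
    have hy' : y = act s x := Subtype.ext hy
    have := congrFun (φ.injective h) ⟨s, hs⟩
    rw [hy'] at this
    exact hne ⟨s, hs⟩ x this

/-! The winding number. -/

/-- lift of an edge -/
def el (p q : Fin 3) : ℤ := if q = p + 1 then 1 else -1

lemma el_odd (p q) : el p q = 1 ∨ el p q = -1 := by unfold el; split_ifs <;> simp
lemma el_anti : ∀ p q, p ≠ q → el p q = - el q p := by decide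
lemma el_sq : ∀ p q r s, p ≠ q → q ≠ r → r ≠ s → s ≠ p →
    el p q + el q r + el r s + el s p = 0 := by decide

/-- winding around the pentagon -/
def wind (d : ℤ → Fin 3) (a : ℤ) : ℤ :=
  el (d a) (d (a+2)) + el (d (a+2)) (d (a+4)) + el (d (a+4)) (d (a+6)) + el (d (a+6)) (d (a+3))
    + el (d (a+3)) (d a)

lemma wind_ne (d a) : wind d a ≠ 0 := by
  unfold wind
  rcases el_odd (d a) (d (a+2)) with h1 | h1 <;>
  rcases el_odd (d (a+2)) (d (a+4)) with h2 | h2 <;>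
  rcases el_odd (d (a+4)) (d (a+6)) with h3 | h3 <;>
  rcases el_odd (d (a+6)) (d (a+3)) with h4 | h4 <;>
  rcases el_odd (d (a+3)) (d a) with h5 | h5 <;> omega

/-- proper coloring of a line -/
def LineProper (d : ℤ → Fin 3) : Prop := (∀ a, d a ≠ d (a+2)) ∧ ∀ a, d a ≠ d (a+3)

lemma sq23 {d : ℤ → Fin 3} (h : LineProper d) (a : ℤ) :
    el (d a) (d (a+2)) + el (d (a+2)) (d (a+5)) = el (d a) (d (a+3)) + el (d (a+3)) (d (a+5)) := by
  have h1 := h.1 a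
  have h2 := h.2 (a+2)
  have h3 := h.1 (a+3)
  have h4 := h.2 a
  rw [add_assoc] at h2 h3
  norm_num at h2 h3
  have := el_sq _ _ _ _ h1 h2 (Ne.symm h3) h4.symm
  have := el_anti _ _ h3
  have := el_anti _ _ h4
  omega

lemma wind_two {d : ℤ → Fin 3} (h : LineProper d) (a : ℤ) : wind d (a+2) = wind d a := by
  have s1 := sq23 h a
  have s2 := sq23 h (a+3)
  have e1 := el_anti _ _ (h.2 a)
  have e2 := el_anti _ _ (h.2 (a+2))
  have e3 := el_anti _ _ (h.2 (a+3))
  have e4 := el_anti _ _ (h.2 (a+5))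
  unfold wind
  simp only [add_assoc] at *
  norm_num at *
  omega

lemma wind_three {d : ℤ → Fin 3} (h : LineProper d) (a : ℤ) : wind d (a+3) = wind d a := by
  have s1 := sq23 h a
  have s2 := sq23 h (a+2)
  have s3 := sq23 h (a+4)
  have e1 := el_anti _ _ (h.2 a)
  have e2 := el_anti _ _ (h.2 (a+3))
  have e3 := el_anti _ _ (h.2 (a+6))
  unfold wind
  simp only [add_assoc] at *
  norm_num at *
  omega

lemma wind_one {d : ℤ → Fin 3} (h : LineProper d) (a : ℤ) : wind d (a+1) = wind d a := by
  have h1 := wind_three h (a-2)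
  have h2 := wind_two h (a-2)
  rw [show a - 2 + 3 = a + 1 by ring] at h1
  rw [show a - 2 + 2 = a by ring] at h2
  rw [h1, ← h2]

lemma wind_const {d : ℤ → Fin 3} (h : LineProper d) (a : ℤ) : wind d a = wind d 0 := by
  induction a using Int.induction_on with
  | zero => rfl
  | succ i ih => rw [wind_one h, ih]
  | pred i ih =>
    rw [← ih, ← wind_one h (-(i:ℤ) - 1)]
    congr 1; ring

lemma prism {p q p' q' : Fin 3} (h1 : p ≠ q) (h2 : p' ≠ q') (h3 : p ≠ p') (h4 : q ≠ q') :
    el p q = el p p' + el p' q' - el q q' := by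
  have := el_sq _ _ _ _ h1 h4 h2.symm h3.symm
  have := el_anti _ _ h3
  have := el_anti _ _ h2
  omega

lemma wind_flip {d d' : ℤ → Fin 3} (h : LineProper d) (h' : LineProper d')
    (hd : ∀ a, d a ≠ d' (-a)) : wind d 0 = - wind d' 0 := by
  rw [← wind_const h' (-6)]
  have a1 := h.1 0
  have a2 := h.1 2
  have a3 := h.1 4
  have a4 := h.2 3
  have a5 := h.2 0
  have b1 := h'.1 (-2)
  have b2 := h'.1 (-4)
  have b3 := h'.1 (-6)
  have b4 := h'.2 (-6)
  have b5 := h'.2 (-3)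
  have c0 := hd 0
  have c2 := hd 2
  have c3 := hd 3
  have c4 := hd 4
  have c6 := hd 6
  unfold wind
  norm_num at *
  have p1 := prism a1 (Ne.symm b1) c0 c2
  have p2 := prism a2 (Ne.symm b2) c2 c4
  have p3 := prism a3 (Ne.symm b3) c4 c6
  have p4 := prism (Ne.symm a4) b4 c6 c3
  have p5 := prism (Ne.symm a5) b5 c3 c0
  have q1 := el_anti _ _ b1
  have q2 := el_anti _ _ b2
  have q3 := el_anti _ _ b3
  have q4 := el_anti _ _ b4
  have q5 := el_anti _ _ b5
  omega

/-! Category argument. -/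

lemma exists_tr_disjoint (I J : Finset DeltaZ) : ∃ n, ∀ i ∈ I, tr n * i ∉ J := by
  classical
  have hfin : (⋃ i ∈ I, ⋃ j ∈ J, {n : ℤ | tr n = j * i⁻¹}).Finite := by
    refine I.finite_toSet.biUnion fun i _ => J.finite_toSet.biUnion fun j _ => ?_
    exact Set.Subsingleton.finite fun a ha b hb => tr_inj (ha.trans hb.symm)
  obtain ⟨n, hn⟩ := hfin.exists_notMem
  refine ⟨n, fun i hi hJ => hn ?_⟩
  simp only [Set.mem_iUnion]
  exact ⟨i, hi, _, hJ, by simp⟩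

lemma exists_tr_meet {U V : Set (DeltaZ → Bool)} (hU : IsOpen U) (hV : IsOpen V)
    (hU' : U.Nonempty) (hV' : V.Nonempty) :
    ∃ n, (shiftMap (tr n) ⁻¹' U ∩ V).Nonempty := by
  classical
  obtain ⟨x, hx⟩ := hU'
  obtain ⟨y, hy⟩ := hV'
  obtain ⟨I, u, hu, hIU⟩ := isOpen_pi_iff.1 hU x hx
  obtain ⟨J, v, hv, hJV⟩ := isOpen_pi_iff.1 hV y hy
  obtain ⟨n, hn⟩ := exists_tr_disjoint I J
  refine ⟨-n, fun k => if k ∈ J then y k else x (tr (-n) * k), hIU ?_, hJV ?_⟩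
  · intro i hi
    have e : (tr (-n))⁻¹ = tr n := by
      rw [inv_eq_iff_mul_eq_one, ← tr_add]; simp [tr_zero]
    have e2 : tr (-n) * (tr n * i) = i := by rw [← e]; simp
    simp only [shiftMap, e, if_neg (hn i hi), e2]
    exact (hu i hi).2
  · intro j hj
    simp only [if_pos (Finset.mem_coe.1 hj)]
    exact (hv j hj).2

lemma isOpen_shift_ne (g : DeltaZ) : IsOpen {x : DeltaZ → Bool | shiftMap g x ≠ x} :=
  isOpen_ne_fun (shiftMap_continuous g) continuous_id

lemma freePart_eq : FreePart DeltaZ = ⋂ g : {g : DeltaZ // g ≠ 1}, {x | shiftMap g.1 x ≠ x} := by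
  ext x; simp [FreePart]

lemma freePart_residual : FreePart DeltaZ ∈ residual (DeltaZ → Bool) := by
  classical
  rw [freePart_eq, countable_iInter_mem]
  rintro ⟨g, hg⟩
  refine residual_of_dense_open (isOpen_shift_ne g) ?_
  rw [dense_iff_inter_open]
  rintro U hU ⟨x, hx⟩
  obtain ⟨I, u, hu, hIU⟩ := isOpen_pi_iff.1 hU x hx
  obtain ⟨k, hk⟩ := Infinite.exists_notMem_finset I
  refine ⟨Function.update x k (!(x (g⁻¹ * k))), hIU ?_, ?_⟩
  · intro i hi
    have : i ≠ k := fun h => hk (h ▸ hi)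
    rw [Function.update_of_ne this]
    exact (hu i hi).2
  · intro h
    have h := congrFun h k
    have hne : g⁻¹ * k ≠ k := by simpa using hg
    simp [shiftMap, Function.update_of_ne hne] at h

lemma freePart_measurable : MeasurableSet (FreePart DeltaZ) := by
  rw [freePart_eq]
  exact MeasurableSet.iInter fun g => (isOpen_shift_ne g.1).measurableSet

lemma shift_residual (g : DeltaZ) {s : Set (DeltaZ → Bool)} (hs : s ∈ residual (DeltaZ → Bool)) :
    shiftMap g ⁻¹' s ∈ residual (DeltaZ → Bool) := by
  refine tendsto_residual_of_isOpenMap (shiftMap_continuous g) ?_ hs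
  intro U hU
  have : shiftMap g '' U = shiftMap g⁻¹ ⁻¹' U := by
    ext x
    constructor
    · rintro ⟨y, hy, rfl⟩
      simpa [← shiftMap_mul, shiftMap_one] using hy
    · intro hx
      exact ⟨_, hx, by simp [← shiftMap_mul, shiftMap_one]⟩
  rw [this]
  exact hU.preimage (shiftMap_continuous _)

lemma shift_eq (g : DeltaZ) {s t : Set (DeltaZ → Bool)} (h : s =ᶠ[residual _] t) :
    shiftMap g ⁻¹' s =ᶠ[residual _] shiftMap g ⁻¹' t := by
  have := shift_residual g h
  exact this

open Filter in
lemma no_split (A : Set (DeltaZ → Bool)) (hA : MeasurableSet A)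
    (hinv : ∀ n, shiftMap (tr n) ⁻¹' A = A)
    (hdisj : ∀ x, x ∈ A → shiftMap fl x ∉ A)
    (hcov : ∀ x ∈ FreePart DeltaZ, x ∈ A ∨ shiftMap fl x ∈ A) : False := by
  set B := shiftMap fl ⁻¹' A with hB
  have hBm : MeasurableSet B := shiftMap_measurable fl hA
  obtain ⟨U, hU, hAU⟩ := hA.residualEq_isOpen
  obtain ⟨V, hV, hBV⟩ := hBm.residualEq_isOpen
  have fin : B =ᶠ[residual _] (∅ : Set (DeltaZ → Bool)) →
      A =ᶠ[residual _] (∅ : Set (DeltaZ → Bool)) → False := by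
    intro h1 h2
    have h3 : ∀ᶠ x in residual (DeltaZ → Bool), x ∈ FreePart DeltaZ := freePart_residual
    obtain ⟨x, hx, hB', hA'⟩ :=
      (dense_of_mem_residual (h3.and ((Filter.eventuallyEq_set.1 h1).and (Filter.eventuallyEq_set.1 h2)))).nonempty
    rcases hcov x hx with h | h
    · exact hA'.1 h
    · exact hB'.1 h
  by_cases hU' : U.Nonempty
  · by_cases hV' : V.Nonempty
    · obtain ⟨n, hn⟩ := exists_tr_meet hU hV hU' hV'
      have h1 := shift_eq (tr n) hAU
      rw [hinv] at h1
      have h2 := h1.inter hBV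
      have h3 : A ∩ B = ∅ := by
        ext x; simp only [Set.mem_inter_iff, Set.mem_empty_iff_false, iff_false]
        exact fun h => hdisj x h.1 h.2
      rw [h3] at h2
      have hd := dense_of_mem_residual h2
      obtain ⟨x, hx, hx2⟩ := hd.inter_open_nonempty _
        ((hU.preimage (shiftMap_continuous _)).inter hV) hn
      exact (Iff.of_eq hx2).2 hx
    · rw [Set.not_nonempty_iff_eq_empty] at hV'
      subst hV'
      have h1 := shift_eq fl⁻¹ hBV
      have h2 : shiftMap fl⁻¹ ⁻¹' B = A := by
        ext x; simp [hB, ← shiftMap_mul, shiftMap_one]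
      rw [h2] at h1
      exact fin hBV h1
  · rw [Set.not_nonempty_iff_eq_empty] at hU'
    subst hU'
    exact fin (shift_eq fl hAU) hAU

lemma no_three : ¬ HasBorelColoring (ShiftAdj SZ) 3 := by
  rintro ⟨c, hc, hcol⟩
  let d : FreePart DeltaZ → ℤ → Fin 3 := fun x a => c (act (tr a) x)
  have hs : ∀ s ∈ SZ, ∀ x, c x ≠ c (act s x) := fun s hs x =>
    hcol _ _ ⟨act_ne (SZ_ne_one hs) x, s, hs, rfl⟩
  have m2 : tr 2 ∈ SZ := by left; rfl
  have m3 : tr 3 ∈ SZ := by right; right; left; rfl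
  have mf : fl ∈ SZ := by right; right; right; right; left; rfl
  have hd : ∀ x, LineProper (d x) := by
    intro x
    constructor
    · intro a
      show c _ ≠ c _
      rw [add_comm, tr_add, act_mul]
      exact hs _ m2 _
    · intro a
      show c _ ≠ c _
      rw [add_comm, tr_add, act_mul]
      exact hs _ m3 _
  have hf : ∀ x a, d x a ≠ d (act fl x) (-a) := by
    intro x a
    show c _ ≠ c _
    rw [← act_mul, ← fl_tr, act_mul]
    exact hs _ mf _
  have htr : ∀ x n, wind (d (act (tr n) x)) 0 = wind (d x) 0 := by
    intro x n
    rw [← wind_const (hd x) n]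
    have : ∀ a, d (act (tr n) x) a = d x (n + a) := by
      intro a
      show c _ = c _
      rw [← act_mul, ← tr_add, add_comm]
    simp [wind, this]
  have hfl : ∀ x, wind (d x) 0 = - wind (d (act fl x)) 0 := fun x =>
    wind_flip (hd x) (hd _) (hf x)
  let A : Set (FreePart DeltaZ) := {x | 0 < wind (d x) 0}
  have hdm : ∀ a, Measurable fun x => d x a := fun a => hc.comp (act_measurable _)
  have hel : Measurable fun p : Fin 3 × Fin 3 => el p.1 p.2 := measurable_of_countable _
  have he : ∀ a b, Measurable fun x => el (d x a) (d x b) := fun a b =>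
    hel.comp ((hdm a).prodMk (hdm b))
  have hA : MeasurableSet A := by
    have : Measurable fun x => wind (d x) 0 := by
      unfold wind
      exact ((((he _ _).add (he _ _)).add (he _ _)).add (he _ _)).add (he _ _)
    exact measurableSet_lt measurable_const this
  have memA : ∀ x : FreePart DeltaZ, x.1 ∈ Subtype.val '' A ↔ 0 < wind (d x) 0 := by
    intro x
    rw [Subtype.val_injective.mem_set_image]
    rfl
  refine no_split (Subtype.val '' A) (freePart_measurable.subtype_image hA) ?_ ?_ ?_
  · intro n
    have key : ∀ n x, x ∈ Subtype.val '' A → shiftMap (tr n) x ∈ Subtype.val '' A := by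
      rintro n _ ⟨x, hx, rfl⟩
      refine (memA (act (tr n) x)).2 ?_
      rw [htr]; exact hx
    ext x
    constructor
    · intro hx
      have := key (-n) _ hx
      rwa [← shiftMap_mul, ← tr_add, neg_add_cancel, tr_zero, shiftMap_one] at this
    · exact key n x
  · rintro _ ⟨x, hx, rfl⟩ h
    have h := (memA (act fl x)).1 h
    have := hfl x
    have hx : 0 < wind (d x) 0 := hx
    omega
  · intro x hx
    by_cases h : 0 < wind (d ⟨x, hx⟩) 0
    · exact Or.inl ((memA ⟨x, hx⟩).2 h)
    · right
      refine (memA (act fl ⟨x, hx⟩)).2 ?_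
      have := hfl ⟨x, hx⟩
      have := wind_ne (d ⟨x, hx⟩) 0
      omega

lemma coloring_mono {m n : ℕ} (h : m ≤ n) (hm : HasBorelColoring (ShiftAdj SZ) m) :
    HasBorelColoring (ShiftAdj SZ) n := by
  obtain ⟨c, hc, h'⟩ := hm
  refine ⟨fun x => Fin.castLE h (c x), (measurable_of_countable (Fin.castLE h)).comp hc, fun x y hxy he => ?_⟩
  exact h' x y hxy (Fin.castLE_injective h he)

end Aux

/-- The Borel chromatic number of the shift graph of
`(ℤ ⋊_φ ℤ, {(±2,0), (±3,0), (0,±1)})` is greater than `3`: there is no Borel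
`3`-coloring of the shift graph. -/
theorem borelChromatic_shift_DeltaZ_gt_three :
    3 < borelChromatic (ShiftAdj SZ) ∧ ¬ HasBorelColoring (ShiftAdj SZ) 3 := by
  refine ⟨?_, no_three⟩
  by_contra! hlt
  exact no_three (coloring_mono hlt (Nat.sInf_mem exists_finite_coloring))
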